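/- Let s : ℝ × ℝ → ℝ be a smooth nowhere-zero function satisfying the interacting soliton KdV equation s² s_t = s² s_xxx − 3 s s_x s_xx + (3/2) s_x³ at every point. Let a, b, c, d be real numbers with ad − bc ≠ 0, and let F : ℝ × ℝ → ℝ be a smooth function with F_x = s and F_t = s_xx − (3/2) s_x²/s at every point, such that cF + d is nowhere zero. Then the function ŝ := (ad − bc) s / (cF + d)² is smooth, nowhere zero, and satisfies the interacting soliton KdV equation ŝ² ŝ_t = ŝ² ŝ_xxx − 3 ŝ ŝ_x ŝ_xx + (3/2) ŝ_x³ at every point. -/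

import Mathlib

/-- Partial derivative with respect to the first (space) variable. -/
noncomputable def px (f : ℝ × ℝ → ℝ) : ℝ × ℝ → ℝ :=
  fun p => deriv (fun x => f (x, p.2)) p.1

/-- Partial derivative with respect to the second (time) variable. -/
noncomputable def pt (f : ℝ × ℝ → ℝ) : ℝ × ℝ → ℝ :=
  fun p => deriv (fun t => f (p.1, t)) p.2


theorem hasDerivAt_px {f : ℝ × ℝ → ℝ} (hf : Differentiable ℝ f) (p : ℝ × ℝ) :
    HasDerivAt (fun x => f (x, p.2)) (px f p) p.1 := by
  have h : Differentiable ℝ (fun x => f (x, p.2)) := by fun_prop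
  exact (h p.1).hasDerivAt

theorem hasDerivAt_pt {f : ℝ × ℝ → ℝ} (hf : Differentiable ℝ f) (p : ℝ × ℝ) :
    HasDerivAt (fun t => f (p.1, t)) (pt f p) p.2 := by
  have h : Differentiable ℝ (fun t => f (p.1, t)) := by fun_prop
  exact (h p.2).hasDerivAt

theorem ContDiff.px {f : ℝ × ℝ → ℝ} (hf : ContDiff ℝ (⊤ : ℕ∞) f) :
    ContDiff ℝ (⊤ : ℕ∞) (px f) := by
  have h : _root_.px f = fun p => fderiv ℝ f p (1, 0) := by
    funext p
    have hline : HasDerivAt (fun x : ℝ => (x, p.2)) ((1 : ℝ), (0 : ℝ)) p.1 :=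
      (hasDerivAt_id p.1).prodMk (hasDerivAt_const p.1 p.2)
    exact ((hf.differentiable (by simp) p).hasFDerivAt.comp_hasDerivAt p.1 hline).deriv
  rw [h]
  exact (hf.fderiv_right (m := (⊤ : ℕ∞)) (by simp)).clm_apply contDiff_const

theorem HasDerivAt.div_pow_succ {u G : ℝ → ℝ} {u' g x : ℝ} (hu : HasDerivAt u u' x)
    (hG : HasDerivAt G g x) (h0 : G x ≠ 0) (n : ℕ) :
    HasDerivAt (fun y => u y / G y ^ (n + 1))
      (u' / G x ^ (n + 1) - (n + 1) * u x * g / G x ^ (n + 2)) x := by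
  refine (hu.fun_div (hG.fun_pow (n + 1)) (pow_ne_zero _ h0)).congr_deriv ?_
  simp only [Nat.add_sub_cancel, Nat.cast_add, Nat.cast_one]
  field_simp
  ring

/-- Auto-Bäcklund transformation of the interacting soliton KdV equation: if `s` solves
`s² s_t = s² s_xxx - 3 s s_x s_xx + (3/2) s_x³`, `ad - bc ≠ 0`, and `F` is a potential
with `F_x = s`, `F_t = s_xx - (3/2) s_x²/s`, with `cF + d` nowhere zero, then
`ŝ := (ad - bc) s / (cF + d)²` is smooth, nowhere zero, and solves the interacting
soliton KdV equation. -/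
theorem intSolKdV_autoBacklund
    (s : ℝ × ℝ → ℝ) (hs : ContDiff ℝ (⊤ : ℕ∞) s) (hs0 : ∀ p, s p ≠ 0)
    (heq : ∀ p, (s p) ^ 2 * pt s p =
      (s p) ^ 2 * px (px (px s)) p - 3 * s p * px s p * px (px s) p + (3/2) * (px s p) ^ 3)
    (a b c d : ℝ) (habcd : a * d - b * c ≠ 0)
    (F : ℝ × ℝ → ℝ) (hF : ContDiff ℝ (⊤ : ℕ∞) F)
    (hFx : ∀ p, px F p = s p)
    (hFt : ∀ p, pt F p = px (px s) p - (3/2) * (px s p) ^ 2 / s p)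
    (hcFd : ∀ p, c * F p + d ≠ 0) :
    ContDiff ℝ (⊤ : ℕ∞) (fun q => (a * d - b * c) * s q / (c * F q + d) ^ 2) ∧
    (∀ p, (fun q => (a * d - b * c) * s q / (c * F q + d) ^ 2) p ≠ 0) ∧
    (∀ p, ((fun q => (a * d - b * c) * s q / (c * F q + d) ^ 2) p) ^ 2 *
          pt (fun q => (a * d - b * c) * s q / (c * F q + d) ^ 2) p =
        ((fun q => (a * d - b * c) * s q / (c * F q + d) ^ 2) p) ^ 2 *
            px (px (px (fun q => (a * d - b * c) * s q / (c * F q + d) ^ 2))) p -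
          3 * (fun q => (a * d - b * c) * s q / (c * F q + d) ^ 2) p *
            px (fun q => (a * d - b * c) * s q / (c * F q + d) ^ 2) p *
            px (px (fun q => (a * d - b * c) * s q / (c * F q + d) ^ 2)) p +
          (3/2) * (px (fun q => (a * d - b * c) * s q / (c * F q + d) ^ 2) p) ^ 3) := by
  have hK (q : ℝ × ℝ) : (a * d - b * c) * s q / (c * F q + d) ^ 2 ≠ 0 :=
    div_ne_zero (mul_ne_zero habcd (hs0 q)) (pow_ne_zero 2 (hcFd q))
  refine ⟨?_, hK, ?_⟩
  · exact (contDiff_const.mul hs).div (((contDiff_const.mul hF).add contDiff_const).pow 2)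
      fun q => pow_ne_zero 2 (hcFd q)
  generalize a * d - b * c = K
  have ds := hs.differentiable (by simp)
  have ds₁ := hs.px.differentiable (by simp)
  have ds₂ := hs.px.px.differentiable (by simp)
  have dF := hF.differentiable (by simp)
  have hGx (p : ℝ × ℝ) : HasDerivAt (fun x => c * F (x, p.2) + d) (c * s p) p.1 := by
    simpa only [hFx] using ((hasDerivAt_px dF p).const_mul c).add_const d
  have hGt (p : ℝ × ℝ) : HasDerivAt (fun t => c * F (p.1, t) + d) (c * pt F p) p.2 :=
    ((hasDerivAt_pt dF p).const_mul c).add_const d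
  have hx : px (fun q => K * s q / (c * F q + d) ^ 2) = fun q =>
      K * px s q / (c * F q + d) ^ 2 - 2 * c * K * s q ^ 2 / (c * F q + d) ^ 3 := by
    funext p
    refine (((hasDerivAt_px ds p).const_mul K).div_pow_succ (hGx p) (hcFd p) 1).deriv.trans ?_
    push_cast
    ring
  have hxx : px (fun q =>
      K * px s q / (c * F q + d) ^ 2 - 2 * c * K * s q ^ 2 / (c * F q + d) ^ 3) = fun q =>
      K * px (px s) q / (c * F q + d) ^ 2 - 6 * c * K * (s q * px s q) / (c * F q + d) ^ 3
        + 6 * c ^ 2 * K * s q ^ 3 / (c * F q + d) ^ 4 := by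
    funext p
    refine ((((hasDerivAt_px ds₁ p).const_mul K).div_pow_succ (hGx p) (hcFd p) 1).fun_sub
      ((((hasDerivAt_px ds p).fun_pow 2).const_mul (2 * c * K)).div_pow_succ
        (hGx p) (hcFd p) 2)).deriv.trans ?_
    push_cast
    ring
  have hxxx (p : ℝ × ℝ) : px (fun q =>
      K * px (px s) q / (c * F q + d) ^ 2 - 6 * c * K * (s q * px s q) / (c * F q + d) ^ 3
        + 6 * c ^ 2 * K * s q ^ 3 / (c * F q + d) ^ 4) p =
      K * px (px (px s)) p / (c * F p + d) ^ 2
        - c * K * (8 * s p * px (px s) p + 6 * px s p ^ 2) / (c * F p + d) ^ 3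
        + 36 * c ^ 2 * K * s p ^ 2 * px s p / (c * F p + d) ^ 4
        - 24 * c ^ 3 * K * s p ^ 4 / (c * F p + d) ^ 5 := by
    refine (((((hasDerivAt_px ds₂ p).const_mul K).div_pow_succ (hGx p) (hcFd p) 1).fun_sub
      ((((hasDerivAt_px ds p).fun_mul (hasDerivAt_px ds₁ p)).const_mul
        (6 * c * K)).div_pow_succ (hGx p) (hcFd p) 2)).fun_add
      ((((hasDerivAt_px ds p).fun_pow 3).const_mul (6 * c ^ 2 * K)).div_pow_succ
        (hGx p) (hcFd p) 3)).deriv.trans ?_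
    push_cast
    ring
  have ht (p : ℝ × ℝ) : pt (fun q => K * s q / (c * F q + d) ^ 2) p =
      K * pt s p / (c * F p + d) ^ 2 - 2 * c * K * s p * pt F p / (c * F p + d) ^ 3 := by
    refine (((hasDerivAt_pt ds p).const_mul K).div_pow_succ (hGt p) (hcFd p) 1).deriv.trans ?_
    push_cast
    ring
  intro p
  have hst : pt s p = px (px (px s)) p - 3 * px s p * px (px s) p / s p
      + (3 / 2) * px s p ^ 3 / s p ^ 2 := by
    have h0 := hs0 p
    field_simp
    linear_combination 2 * heq p
  simp only [hx, hxx, hxxx, ht, hst, hFt]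
  have h0 := hs0 p
  have hG := hcFd p
  generalize c * F p + d = G at hG ⊢
  field_simp
  ring
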